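/- arXiv:2404.10398 — 2 statements merged into one kernel-verified Lean document; each statement's English description precedes it below -/
import Mathlib

section
/- For any ϱ₁, ϱ₂ with −∞ < ϱ₂ < ϱ₁ < 0, one has 0 ≤ K_t(ϱ₁) ≤ K_t(ϱ₂) (in the sense of symmetric matrices) for all t ∈ (t_{ϱ₂}, T]; consequently the blow-up time is a decreasing function of ϱ on (−∞, 0): t_{ϱ₁} ≤ t_{ϱ₂}. -/
open Filter Matrix Set

attribute [local instance] Matrix.normedAddCommGroup Matrix.normedSpace

/-- Right-hand side of the matrix Riccati equation `−K̇ = Ric ϱ t K`. -/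
noncomputable def Ric {n : ℕ}
    (H11 H12 H13 H14 H21 H22 H23 H24 H31 H32 H33 H41 H42 H44 :
      ℝ → Matrix (Fin n) (Fin n) ℝ) (ϱ t : ℝ)
    (K : Matrix (Fin n) (Fin n) ℝ) : Matrix (Fin n) (Fin n) ℝ :=
  K * H21 t + H12 t * K + H11 t + ϱ • (K * H22 t * K)
    + (ϱ ^ 2) • ((K * H23 t + H13 t) * ((1 - K * H33 t)⁻¹ * K) * (H31 t + H32 t * K))
    + (ϱ ^ 2) • ((K * H24 t + H14 t) * ((1 - K * H44 t)⁻¹ * K) * (H41 t + H42 t * K))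


lemma aux_compact (n : ℕ) : IsCompact {v : Fin n → ℝ | v ⬝ᵥ v = 1} := by
  have hcl : IsClosed {v : Fin n → ℝ | v ⬝ᵥ v = 1} :=
    isClosed_eq (by unfold dotProduct; fun_prop) continuous_const
  refine (isCompact_closedBall (0 : Fin n → ℝ) 1).of_isClosed_subset hcl ?_
  intro v hv
  simp only [mem_ofPred_eq] at hv
  rw [mem_closedBall_zero_iff, pi_norm_le_iff_of_nonneg zero_le_one]
  intro i
  have h1 : v i * v i ≤ v ⬝ᵥ v :=
    Finset.single_le_sum (f := fun i => v i * v i) (fun j _ => mul_self_nonneg _) (Finset.mem_univ i)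
  rw [Real.norm_eq_abs, abs_le]
  constructor <;> nlinarith

/-- quadratic form as linear map -/
noncomputable def qL {n : ℕ} (v : Fin n → ℝ) : Matrix (Fin n) (Fin n) ℝ →ₗ[ℝ] ℝ where
  toFun A := v ⬝ᵥ (A *ᵥ v)
  map_add' A B := by simp [add_mulVec]
  map_smul' c A := by simp [smul_mulVec]

lemma aux_qcont {n : ℕ} {X : Type*} [TopologicalSpace X] {s : Set X}
    {f : X → Fin n → ℝ} {A : X → Matrix (Fin n) (Fin n) ℝ}
    (hf : ContinuousOn f s) (hA : ContinuousOn A s) :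
    ContinuousOn (fun x => f x ⬝ᵥ (A x *ᵥ f x)) s := by
  rw [continuousOn_iff_continuous_domRestrict] at *
  exact hf.dotProduct (hA.matrix_mulVec hf)

lemma aux_psd {n : ℕ} {A : Matrix (Fin n) (Fin n) ℝ} (hA : Aᵀ = A)
    (h : ∀ v, 0 ≤ v ⬝ᵥ (A *ᵥ v)) : A.PosSemidef := by
  refine Matrix.PosSemidef.of_dotProduct_mulVec_nonneg (by rw [IsHermitian, conjTranspose_eq_transpose_of_trivial]; exact hA) ?_
  intro v; simpa using h v

lemma aux_tr {n : ℕ} {A : Matrix (Fin n) (Fin n) ℝ} (hA : A.PosSemidef) : Aᵀ = A := by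
  have := hA.1
  rwa [IsHermitian, conjTranspose_eq_transpose_of_trivial] at this

lemma aux_nn {n : ℕ} {A : Matrix (Fin n) (Fin n) ℝ} (hA : A.PosSemidef) (v : Fin n → ℝ) :
    0 ≤ v ⬝ᵥ (A *ᵥ v) := by simpa using hA.dotProduct_mulVec_nonneg v

lemma aux_scale {n : ℕ} {A : Matrix (Fin n) (Fin n) ℝ}
    (h : ∀ v : Fin n → ℝ, v ⬝ᵥ v = 1 → 0 ≤ v ⬝ᵥ (A *ᵥ v)) (v) : 0 ≤ v ⬝ᵥ (A *ᵥ v) := by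
  by_cases hv : v = 0
  · simp [hv]
  have hp : 0 < v ⬝ᵥ v := by
    rcases (dotProduct_self_star_nonneg v).lt_or_eq with h | h
    · simpa using h
    · exact absurd (dotProduct_self_eq_zero.1 (by simpa using h.symm)) hv
  have := h ((√(v ⬝ᵥ v))⁻¹ • v) (by
    simp only [dotProduct_smul, smul_dotProduct, smul_eq_mul]
    have := Real.mul_self_sqrt hp.le
    have h2 := Real.sqrt_pos.2 hp
    field_simp; nlinarith)
  simp only [dotProduct_smul, smul_dotProduct, smul_eq_mul, mulVec_smul] at this
  have h2 := inv_pos.2 (Real.sqrt_pos.2 hp)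
  exact nonneg_of_mul_nonneg_right (nonneg_of_mul_nonneg_right this h2) h2

lemma aux_comp {n : ℕ} {a T : ℝ} (D R Q : ℝ → Matrix (Fin n) (Fin n) ℝ)
    (hD : ContinuousOn D (Icc a T)) (hQ : ContinuousOn Q (Icc a T))
    (hDT : D T = 0) (hsym : ∀ t ∈ Icc a T, (D t)ᵀ = D t)
    (hder : ∀ t ∈ Icc a T, t < T → HasDerivAt D (-(R t)) t)
    (hR : ∀ t ∈ Icc a T, ∀ δ : ℝ, 0 < δ → ∀ v : Fin n → ℝ,
      (∀ x, -δ * (x ⬝ᵥ x) ≤ x ⬝ᵥ (D t *ᵥ x)) → D t *ᵥ v = -δ • v →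
        -δ * (v ⬝ᵥ (Q t *ᵥ v)) ≤ v ⬝ᵥ (R t *ᵥ v)) :
    ∀ t ∈ Icc a T, (D t).PosSemidef := by
  have hc := aux_compact n
  have hcp := (isCompact_Icc (a := a) (b := T)).prod hc
  have hQc : ContinuousOn (fun p : ℝ × (Fin n → ℝ) => p.2 ⬝ᵥ (Q p.1 *ᵥ p.2))
      (Icc a T ×ˢ {v : Fin n → ℝ | v ⬝ᵥ v = 1}) :=
    aux_qcont continuousOn_snd (hQ.comp continuousOn_fst (fun p hp => hp.1))
  obtain ⟨C, hC⟩ := hcp.bddAbove_image hQc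
  have hC' : ∀ t ∈ Icc a T, ∀ v : Fin n → ℝ, v ⬝ᵥ v = 1 → v ⬝ᵥ (Q t *ᵥ v) ≤ C :=
    fun t ht v hv => hC ⟨(t, v), ⟨ht, hv⟩, rfl⟩
  have key : ∀ ε : ℝ, 0 < ε → ∀ t ∈ Icc a T, ∀ v : Fin n → ℝ, v ⬝ᵥ v = 1 →
      0 < v ⬝ᵥ (D t *ᵥ v) + ε * Real.exp ((C+1)*(T-t)) := by
    intro ε hε
    by_contra! hcon
    have hφc : ContinuousOn (fun p : ℝ × (Fin n → ℝ) => p.2 ⬝ᵥ (D p.1 *ᵥ p.2)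
        + ε * Real.exp ((C+1)*(T-p.1))) (Icc a T ×ˢ {v : Fin n → ℝ | v ⬝ᵥ v = 1}) :=
      (aux_qcont continuousOn_snd (hD.comp continuousOn_fst (fun p hp => hp.1))).add
        (by fun_prop)
    have hSc := (hφc.preimage_isClosed_of_isClosed hcp.isClosed (isClosed_Iic (a := (0:ℝ))))
    have hS := hcp.of_isClosed_subset hSc inter_subset_left
    obtain ⟨t0, ht0, v0, hv0, h0⟩ := hcon
    obtain ⟨⟨s, v⟩, ⟨⟨hs, hv⟩, hle⟩, hmax⟩ := hS.exists_isMaxOn ⟨(t0, v0), ⟨ht0, hv0⟩, h0⟩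
      continuous_fst.continuousOn
    simp only [mem_ofPred_eq, mem_preimage, mem_Iic] at hs hv hle
    have hpos : ∀ t ∈ Ioc s T, ∀ w : Fin n → ℝ, w ⬝ᵥ w = 1 →
        0 < w ⬝ᵥ (D t *ᵥ w) + ε * Real.exp ((C+1)*(T-t)) := by
      intro t ht w hw
      by_contra! hh
      have := hmax (a := (t, w)) ⟨⟨⟨hs.1.trans ht.1.le, ht.2⟩, hw⟩, hh⟩
      simp only [mem_ofPred_eq] at this
      linarith [ht.1]
    have hsT : s < T := by
      refine lt_of_le_of_ne hs.2 ?_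
      rintro rfl
      simp [hDT] at hle
      linarith
    set δ := ε * Real.exp ((C+1)*(T-s)) with hδ
    have hδ0 : 0 < δ := by positivity
    have hder' : ∀ w : Fin n → ℝ, HasDerivAt
        (fun t => w ⬝ᵥ (D t *ᵥ w) + ε * Real.exp ((C+1)*(T-t)))
        (-(w ⬝ᵥ (R s *ᵥ w)) + -(C+1) * δ) s := by
      intro w
      have h1 : HasDerivAt (fun t => qL w (D t)) (qL w (-(R s))) s :=
        (LinearMap.toContinuousLinearMap (qL w)).hasFDerivAt.comp_hasDerivAt s (hder s hs hsT)
      have h2 : HasDerivAt (fun t => ε * Real.exp ((C+1)*(T-t))) (-(C+1) * δ) s := by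
        have := ((((hasDerivAt_id s).const_sub T).const_mul (C+1)).exp).const_mul ε
        refine this.congr_deriv ?_
        simp only [hδ, id]; ring
      rw [map_neg] at h1
      exact h1.add h2
    have hnn : ∀ w : Fin n → ℝ, w ⬝ᵥ w = 1 → 0 ≤ w ⬝ᵥ (D s *ᵥ w) + δ := by
      intro w hw
      have := (hder' w).continuousAt.tendsto.mono_left (nhdsWithin_le_nhds (s := Ioi s))
      refine ge_of_tendsto this ?_
      filter_upwards [Ioc_mem_nhdsGT hsT] with t ht
      exact (hpos t ht w hw).le
    have hE : (D s + δ • (1 : Matrix (Fin n) (Fin n) ℝ)).PosSemidef := by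
      refine aux_psd (by simp [hsym s hs]) (aux_scale ?_)
      intro w hw
      simpa [add_mulVec, smul_mulVec, hw] using hnn w hw
    have hEv : (D s + δ • (1 : Matrix (Fin n) (Fin n) ℝ)) *ᵥ v = 0 := by
      rw [← hE.dotProduct_mulVec_zero_iff]
      have := hnn v hv
      simp [add_mulVec, smul_mulVec, hv]
      linarith
    have hDv : D s *ᵥ v = -δ • v := by
      rw [add_mulVec, smul_mulVec, one_mulVec] at hEv
      rw [neg_smul]; exact eq_neg_of_add_eq_zero_left hEv
    have hRv := hR s hs δ hδ0 v (fun x => by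
      have := aux_nn hE x
      simp [add_mulVec, smul_mulVec] at this
      linarith) hDv
    have hCv := hC' s hs v hv
    have hneg : -(v ⬝ᵥ (R s *ᵥ v)) + -(C+1) * δ < 0 := by nlinarith
    have hsl := (hasDerivAt_iff_tendsto_slope.1 (hder' v)).eventually (gt_mem_nhds hneg)
    have hsl' := hsl.filter_mono (nhdsWithin_mono s (s := Ioi s) (fun x (hx : s < x) => hx.ne'))
    obtain ⟨t, ht, ht2⟩ := (hsl'.and (Ioc_mem_nhdsGT hsT)).exists
    rw [slope_def_field] at ht
    have hts : 0 < t - s := sub_pos.2 ht2.1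
    have h5 := (div_lt_iff₀ hts).1 ht
    have h6 := hpos t ht2 v hv
    linarith
  intro t ht
  refine aux_psd (hsym t ht) (aux_scale ?_)
  intro v hv
  by_contra! hlt
  have := key (-(v ⬝ᵥ (D t *ᵥ v)) * (Real.exp ((C+1)*(T-t)))⁻¹)
    (mul_pos (by linarith) (inv_pos.2 (Real.exp_pos _))) t ht v hv
  rw [inv_mul_cancel_right₀ (Real.exp_pos _).ne'] at this
  linarith

lemma aux_norm {n : ℕ} {A B : Matrix (Fin n) (Fin n) ℝ} (hA : A.PosSemidef)
    (hAB : (B - A).PosSemidef) : ‖A‖ ≤ ‖B‖ := by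
  rw [Matrix.norm_le_iff (norm_nonneg B)]
  have hd : ∀ i, A i i ≤ ‖B‖ := fun i => by
    have h1 := hAB.diag_nonneg (i := i)
    have h2 := (le_abs_self (B i i)).trans (Matrix.norm_entry_le_entrywise_sup_norm B (i := i) (j := i))
    simp at h1
    linarith
  intro i j
  have hs : A j i = A i j := by simpa using congrFun (congrFun hA.1 i) j
  have h1 := aux_nn hA (Pi.single i 1 + Pi.single j 1)
  have h2 := aux_nn hA (Pi.single i 1 - Pi.single j 1)
  simp [mulVec_add, mulVec_sub, hs] at h1 h2
  have := hd i
  have := hd j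
  rw [Real.norm_eq_abs, abs_le]
  constructor <;> linarith

lemma aux_unit {n : ℕ} {K H : Matrix (Fin n) (Fin n) ℝ} (hK : K.PosSemidef)
    (hH : ∀ x, x ⬝ᵥ (H *ᵥ x) ≤ 0) : IsUnit (1 - H * K).det := by
  rw [isUnit_iff_ne_zero]
  intro h0
  obtain ⟨x, hx, hx0⟩ := Matrix.exists_mulVec_eq_zero_iff.2 h0
  rw [sub_mulVec, one_mulVec, ← mulVec_mulVec, sub_eq_zero] at hx0
  have h1 := hH (K *ᵥ x)
  rw [← hx0, dotProduct_comm] at h1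
  have h2 : K *ᵥ x = 0 := by
    rw [← hK.dotProduct_mulVec_zero_iff]
    simpa using le_antisymm h1 (aux_nn hK x)
  rw [h2] at hx0
  simp at hx0
  exact hx hx0

lemma aux_symm {n : ℕ} {A : Matrix (Fin n) (Fin n) ℝ} (hA : Aᵀ = A) (x y : Fin n → ℝ) :
    x ⬝ᵥ (A *ᵥ y) = y ⬝ᵥ (A *ᵥ x) := by
  rw [dotProduct_mulVec, ← mulVec_transpose, hA, dotProduct_comm]

/-- F w = K x with x - H K x = w -/
lemma aux_F {n : ℕ} {K H : Matrix (Fin n) (Fin n) ℝ} (hK : K.PosSemidef) (hHs : Hᵀ = H)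
    (hH : ∀ x, x ⬝ᵥ (H *ᵥ x) ≤ 0) (w : Fin n → ℝ) :
    ((1 - H * K)⁻¹ *ᵥ w) - H *ᵥ (K *ᵥ ((1 - H * K)⁻¹ *ᵥ w)) = w ∧
    ((1 - K * H)⁻¹ * K) *ᵥ w = K *ᵥ ((1 - H * K)⁻¹ *ᵥ w) := by
  have hu := aux_unit hK hH
  have hKs : Kᵀ = K := aux_tr hK
  have hu' : IsUnit (1 - K * H).det := by
    rw [← det_transpose]; simpa [hKs, hHs] using hu
  constructor
  · have : (1 - H * K) *ᵥ ((1 - H * K)⁻¹ *ᵥ w) = w := by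
      rw [mulVec_mulVec, mul_nonsing_inv _ hu, one_mulVec]
    rwa [sub_mulVec, one_mulVec, ← mulVec_mulVec] at this
  · rw [mulVec_mulVec]
    congr 1
    have h1 : K * (1 - H * K) = (1 - K * H) * K := by noncomm_ring
    calc (1 - K * H)⁻¹ * K = (1 - K * H)⁻¹ * (K * (1 - H * K)) * (1 - H * K)⁻¹ := by
          rw [← Matrix.mul_assoc, mul_nonsing_inv_cancel_right _ _ hu]
      _ = K * (1 - H * K)⁻¹ := by
          rw [h1, nonsing_inv_mul_cancel_left _ _ hu']

lemma aux_Fnn {n : ℕ} {K H : Matrix (Fin n) (Fin n) ℝ} (hK : K.PosSemidef) (hHs : Hᵀ = H)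
    (hH : ∀ x, x ⬝ᵥ (H *ᵥ x) ≤ 0) (w : Fin n → ℝ) :
    0 ≤ w ⬝ᵥ (((1 - K * H)⁻¹ * K) *ᵥ w) := by
  obtain ⟨h1, h2⟩ := aux_F hK hHs hH w
  rw [h2]
  generalize (1 - H * K)⁻¹ *ᵥ w = x at *
  rw [← h1, sub_dotProduct, dotProduct_comm (H *ᵥ _)]
  linarith [aux_nn hK x, hH (K *ᵥ x)]

lemma aux_Fsymm {n : ℕ} {K H : Matrix (Fin n) (Fin n) ℝ} (hK : K.PosSemidef) (hHs : Hᵀ = H)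
    (hH : ∀ x, x ⬝ᵥ (H *ᵥ x) ≤ 0) : ((1 - K * H)⁻¹ * K)ᵀ = (1 - K * H)⁻¹ * K := by
  have hKs : Kᵀ = K := aux_tr hK
  have : (1 - K * H)⁻¹ * K = K * (1 - H * K)⁻¹ := by
    apply Matrix.ext_of_mulVec_single
    intro i
    rw [(aux_F hK hHs hH _).2, mulVec_mulVec]
  rw [transpose_mul, transpose_nonsing_inv, transpose_sub, transpose_mul, hKs, hHs, this]
  simp

lemma aux_Fdiff {n : ℕ} {K₁ K₂ H : Matrix (Fin n) (Fin n) ℝ} (hK₁ : K₁.PosSemidef)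
    (hK₂ : K₂.PosSemidef) (hHs : Hᵀ = H)
    (hH : ∀ x, x ⬝ᵥ (H *ᵥ x) ≤ 0) (w : Fin n → ℝ) :
    ((1 - H * K₂)⁻¹ *ᵥ w) ⬝ᵥ ((K₂ - K₁) *ᵥ ((1 - H * K₂)⁻¹ *ᵥ w)) ≤
    w ⬝ᵥ (((1 - K₂ * H)⁻¹ * K₂) *ᵥ w) - w ⬝ᵥ (((1 - K₁ * H)⁻¹ * K₁) *ᵥ w) := by
  have hKs : K₁ᵀ = K₁ := aux_tr hK₁
  obtain ⟨h1, h2⟩ := aux_F hK₁ hHs hH w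
  obtain ⟨h3, h4⟩ := aux_F hK₂ hHs hH w
  rw [h2, h4]
  generalize (1 - H * K₁)⁻¹ *ᵥ w = x at *
  generalize (1 - H * K₂)⁻¹ *ᵥ w = y at *
  -- e = y - x = H q, q = K₂ y - K₁ x
  have hq := hH (K₂ *ᵥ y - K₁ *ᵥ x)
  have he := aux_nn hK₁ (y - x)
  have s1 := aux_symm hKs x y
  have s2 := aux_symm hHs (K₂ *ᵥ y) (K₁ *ᵥ x)
  have e1 : w ⬝ᵥ (K₂ *ᵥ y) = y ⬝ᵥ (K₂ *ᵥ y) - (K₂ *ᵥ y) ⬝ᵥ (H *ᵥ (K₂ *ᵥ y)) := by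
    conv_lhs => rw [← h3]
    rw [sub_dotProduct, dotProduct_comm (H *ᵥ _)]
  have e2 : w ⬝ᵥ (K₁ *ᵥ x) = x ⬝ᵥ (K₁ *ᵥ x) - (K₁ *ᵥ x) ⬝ᵥ (H *ᵥ (K₁ *ᵥ x)) := by
    conv_lhs => rw [← h1]
    rw [sub_dotProduct, dotProduct_comm (H *ᵥ _)]
  have e3 : w ⬝ᵥ (K₁ *ᵥ x) = y ⬝ᵥ (K₁ *ᵥ x) - (K₁ *ᵥ x) ⬝ᵥ (H *ᵥ (K₂ *ᵥ y)) := by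
    conv_lhs => rw [← h3]
    rw [sub_dotProduct, dotProduct_comm (H *ᵥ _)]
  simp only [mulVec_sub, sub_mulVec, sub_dotProduct, dotProduct_sub] at *
  linarith

lemma aux_inv {n : ℕ} {s : Set ℝ} {A : ℝ → Matrix (Fin n) (Fin n) ℝ} (hA : ContinuousOn A s)
    (hu : ∀ t ∈ s, IsUnit (A t).det) : ContinuousOn (fun t => (A t)⁻¹) s := by
  have h1 : ContinuousOn (fun t => (A t).det) s := by
    rw [continuousOn_iff_continuous_domRestrict] at *
    exact hA.matrix_det
  have h2 : ContinuousOn (fun t => (A t).adjugate) s := by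
    rw [continuousOn_iff_continuous_domRestrict] at *
    exact hA.matrix_adjugate
  have h3 : ContinuousOn (fun t => ((A t).det)⁻¹ • (A t).adjugate) s :=
    (h1.inv₀ (fun t ht => (hu t ht).ne_zero)).smul h2
  refine h3.congr ?_
  intro t _
  simp [Matrix.inv_def]

lemma aux_mul {n : ℕ} {s : Set ℝ} {A B : ℝ → Matrix (Fin n) (Fin n) ℝ} (hA : ContinuousOn A s)
    (hB : ContinuousOn B s) : ContinuousOn (fun t => A t * B t) s := by
  rw [continuousOn_iff_continuous_domRestrict] at *
  exact hA.matrix_mul hB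

/-- correction matrix for one F-term -/
noncomputable def qF {n : ℕ} (K₁ K₂ H L M : Matrix (Fin n) (Fin n) ℝ) : Matrix (Fin n) (Fin n) ℝ :=
  ((1 - H * K₂)⁻¹ * (L + M * K₂))ᵀ * ((1 - H * K₂)⁻¹ * (L + M * K₂)) +
    Mᵀ * (((1 - K₁ * H)⁻¹ * K₁) * ((L + M * K₂) + (L + M * K₁)))

lemma aux_qFc {n : ℕ} {s : Set ℝ} {K₁ K₂ H L M : ℝ → Matrix (Fin n) (Fin n) ℝ}
    (h1 : ContinuousOn K₁ s) (h2 : ContinuousOn K₂ s) (hH : ContinuousOn H s)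
    (hL : ContinuousOn L s) (hM : ContinuousOn M s)
    (hK₁ : ∀ t ∈ s, (K₁ t).PosSemidef) (hK₂ : ∀ t ∈ s, (K₂ t).PosSemidef)
    (hHs : ∀ t ∈ s, (H t)ᵀ = H t)
    (hHn : ∀ t ∈ s, ∀ x, x ⬝ᵥ (H t *ᵥ x) ≤ 0) :
    ContinuousOn (fun t => qF (K₁ t) (K₂ t) (H t) (L t) (M t)) s := by
  have tr : ∀ {A : ℝ → Matrix (Fin n) (Fin n) ℝ}, ContinuousOn A s →
      ContinuousOn (fun t => (A t)ᵀ) s := by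
    intro A hA
    rw [continuousOn_iff_continuous_domRestrict] at *
    exact hA.matrix_transpose
  have g2 : ContinuousOn (fun t => (1 - H t * K₂ t)⁻¹) s :=
    aux_inv (continuousOn_const.sub (aux_mul hH h2)) (fun t ht => aux_unit (hK₂ t ht) (hHn t ht))
  have g1 : ContinuousOn (fun t => (1 - K₁ t * H t)⁻¹) s :=
    aux_inv (continuousOn_const.sub (aux_mul h1 hH)) (fun t ht => by
      have hKs : (K₁ t)ᵀ = K₁ t := aux_tr (hK₁ t ht)
      rw [← det_transpose]
      simpa [hKs, hHs t ht] using aux_unit (hK₁ t ht) (hHn t ht))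
  have b1 := hL.add (aux_mul hM h1)
  have b2 := hL.add (aux_mul hM h2)
  have c := aux_mul g2 b2
  exact (aux_mul (tr c) c).add (aux_mul (tr hM) (aux_mul (aux_mul g1 h1) (b2.add b1)))

lemma aux_quad {n : ℕ} (B F : Matrix (Fin n) (Fin n) ℝ) (v : Fin n → ℝ) :
    v ⬝ᵥ ((Bᵀ * F * B) *ᵥ v) = (B *ᵥ v) ⬝ᵥ (F *ᵥ (B *ᵥ v)) := by
  rw [← mulVec_mulVec, ← mulVec_mulVec, dotProduct_mulVec, ← mulVec_transpose, transpose_transpose]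

lemma aux_term {n : ℕ} {K₁ K₂ H L M : Matrix (Fin n) (Fin n) ℝ} (hK₁ : K₁.PosSemidef)
    (hK₂ : K₂.PosSemidef) (hHs : Hᵀ = H) (hH : ∀ x, x ⬝ᵥ (H *ᵥ x) ≤ 0) (δ : ℝ)
    (v : Fin n → ℝ) (hD : ∀ x, -δ * (x ⬝ᵥ x) ≤ x ⬝ᵥ ((K₂ - K₁) *ᵥ x))
    (hv : (K₂ - K₁) *ᵥ v = -δ • v) :
    -δ * (v ⬝ᵥ (qF K₁ K₂ H L M *ᵥ v)) ≤
     ((L + M * K₂) *ᵥ v) ⬝ᵥ (((1 - K₂ * H)⁻¹ * K₂) *ᵥ ((L + M * K₂) *ᵥ v)) -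
     ((L + M * K₁) *ᵥ v) ⬝ᵥ (((1 - K₁ * H)⁻¹ * K₁) *ᵥ ((L + M * K₁) *ᵥ v)) := by
  have hd := aux_Fdiff hK₁ hK₂ hHs hH ((L + M * K₂) *ᵥ v)
  have hs := aux_Fsymm hK₁ hHs hH
  have hx := hD ((1 - H * K₂)⁻¹ *ᵥ ((L + M * K₂) *ᵥ v))
  have e1 := aux_quad ((1 - H * K₂)⁻¹ * (L + M * K₂)) 1 v
  have hw : (L + M * K₂) *ᵥ v = (L + M * K₁) *ᵥ v - δ • (M *ᵥ v) := by
    have : (L + M * K₂) *ᵥ v = (L + M * K₁) *ᵥ v + M *ᵥ ((K₂ - K₁) *ᵥ v) := by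
      rw [mulVec_mulVec, ← add_mulVec]; congr 1; noncomm_ring
    rw [this, hv, mulVec_smul, neg_smul, sub_eq_add_neg]
  have e2 : v ⬝ᵥ ((Mᵀ * (((1 - K₁ * H)⁻¹ * K₁) * ((L + M * K₂) + (L + M * K₁)))) *ᵥ v)
     = (M *ᵥ v) ⬝ᵥ (((1 - K₁ * H)⁻¹ * K₁) *ᵥ ((L + M * K₂) *ᵥ v + (L + M * K₁) *ᵥ v)) := by
    rw [← mulVec_mulVec, dotProduct_mulVec, ← mulVec_transpose, transpose_transpose,
      ← mulVec_mulVec, add_mulVec]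
  unfold qF
  rw [add_mulVec, dotProduct_add, e2]
  rw [Matrix.mul_one, one_mulVec, ← mulVec_mulVec v ((1 - H * K₂)⁻¹)] at e1
  rw [e1]
  generalize (1 - K₁ * H)⁻¹ * K₁ = F at *
  generalize (1 - K₂ * H)⁻¹ * K₂ = F2 at *
  have h3 : ((L + M * K₂) *ᵥ v) ⬝ᵥ (F *ᵥ ((L + M * K₂) *ᵥ v)) -
     ((L + M * K₁) *ᵥ v) ⬝ᵥ (F *ᵥ ((L + M * K₁) *ᵥ v)) =
     -δ * ((M *ᵥ v) ⬝ᵥ (F *ᵥ ((L + M * K₂) *ᵥ v + (L + M * K₁) *ᵥ v))) := by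
    have s1 := aux_symm hs ((L + M * K₁) *ᵥ v) (M *ᵥ v)
    rw [hw]
    simp only [mulVec_sub, mulVec_add, mulVec_smul, sub_dotProduct, dotProduct_sub, dotProduct_add,
      dotProduct_smul, smul_dotProduct, smul_eq_mul] at *
    rw [s1]; ring
  linarith

lemma aux_ric {n : ℕ}
    (H11 H12 H13 H14 H21 H22 H23 H24 H31 H32 H33 H41 H42 H44 :
      ℝ → Matrix (Fin n) (Fin n) ℝ) (ϱ t : ℝ)
    (K : Matrix (Fin n) (Fin n) ℝ) (hK : K.PosSemidef)
    (h12 : (H12 t)ᵀ = H21 t) (h13 : (H13 t)ᵀ = H31 t) (h14 : (H14 t)ᵀ = H41 t)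
    (h23 : (H23 t)ᵀ = H32 t) (h24 : (H24 t)ᵀ = H42 t) (v : Fin n → ℝ) :
    v ⬝ᵥ (Ric H11 H12 H13 H14 H21 H22 H23 H24 H31 H32 H33 H41 H42 H44 ϱ t K *ᵥ v) =
      2 * ((K *ᵥ v) ⬝ᵥ (H21 t *ᵥ v)) + v ⬝ᵥ (H11 t *ᵥ v)
        + ϱ * ((K *ᵥ v) ⬝ᵥ (H22 t *ᵥ (K *ᵥ v)))
        + ϱ ^ 2 * (((H31 t + H32 t * K) *ᵥ v) ⬝ᵥ
          (((1 - K * H33 t)⁻¹ * K) *ᵥ ((H31 t + H32 t * K) *ᵥ v)))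
        + ϱ ^ 2 * (((H41 t + H42 t * K) *ᵥ v) ⬝ᵥ
          (((1 - K * H44 t)⁻¹ * K) *ᵥ ((H41 t + H42 t * K) *ᵥ v))) := by
  have hs := aux_tr hK
  have e3 : K * H23 t + H13 t = (H31 t + H32 t * K)ᵀ := by
    rw [← h13, ← h23]; simp [hs, add_comm]
  have e4 : K * H24 t + H14 t = (H41 t + H42 t * K)ᵀ := by
    rw [← h14, ← h24]; simp [hs, add_comm]
  have e2 := aux_quad K (H22 t) v
  rw [hs] at e2
  have e1 : v ⬝ᵥ ((K * H21 t) *ᵥ v) = (K *ᵥ v) ⬝ᵥ (H21 t *ᵥ v) := by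
    rw [← mulVec_mulVec, dotProduct_mulVec, ← mulVec_transpose, hs]
  have e0 : v ⬝ᵥ ((H12 t * K) *ᵥ v) = (K *ᵥ v) ⬝ᵥ (H21 t *ᵥ v) := by
    rw [← mulVec_mulVec, dotProduct_mulVec, ← mulVec_transpose, h12, dotProduct_comm]
  unfold Ric
  rw [e3, e4]
  simp only [add_mulVec (_ * _), add_mulVec (_ + _) (H11 t), add_mulVec (_ + _) (_ • _), smul_mulVec, dotProduct_add, dotProduct_smul, smul_eq_mul,
    aux_quad, e2, e1, e0]
  ring

set_option maxHeartbeats 2000000 in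
/-- for `ϱ₂ < ϱ₁ < 0`, `0 ≤ K_t(ϱ₁) ≤ K_t(ϱ₂)` on `(t_{ϱ₂}, T]`,
and the blow-up time is decreasing in `ϱ`: `t_{ϱ₁} ≤ t_{ϱ₂}`. -/
theorem stmt_9
    (T : ℝ) (hT : 0 < T) (n : ℕ) (hn : 1 ≤ n) (β : ℝ) (hβ : 0 < β)
    (H11 H12 H13 H14 H21 H22 H23 H24 H31 H32 H33 H41 H42 H44 :
      ℝ → Matrix (Fin n) (Fin n) ℝ)
    (hc11 : Continuous H11) (hc12 : Continuous H12) (hc13 : Continuous H13)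
    (hc14 : Continuous H14) (hc21 : Continuous H21) (hc22 : Continuous H22)
    (hc23 : Continuous H23) (hc24 : Continuous H24) (hc31 : Continuous H31)
    (hc32 : Continuous H32) (hc33 : Continuous H33) (hc41 : Continuous H41)
    (hc42 : Continuous H42) (hc44 : Continuous H44)
    (hsym : ∀ t : ℝ, (H11 t)ᵀ = H11 t ∧ (H12 t)ᵀ = H21 t ∧ (H13 t)ᵀ = H31 t ∧
      (H14 t)ᵀ = H41 t ∧ (H22 t)ᵀ = H22 t ∧ (H23 t)ᵀ = H32 t ∧
      (H24 t)ᵀ = H42 t ∧ (H33 t)ᵀ = H33 t ∧ (H44 t)ᵀ = H44 t)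
    (hconst : ∀ t : ℝ, t ≤ 0 → H11 t = H11 0 ∧ H12 t = H12 0 ∧ H13 t = H13 0 ∧
      H14 t = H14 0 ∧ H21 t = H21 0 ∧ H22 t = H22 0 ∧ H23 t = H23 0 ∧
      H24 t = H24 0 ∧ H31 t = H31 0 ∧ H32 t = H32 0 ∧ H33 t = H33 0 ∧
      H41 t = H41 0 ∧ H42 t = H42 0 ∧ H44 t = H44 0)
    (hmono : ∀ t : ℝ, t ≤ T → ∀ x y z θ : Fin n → ℝ,
      -(((H11 t).mulVec x + (H12 t).mulVec y + (H13 t).mulVec z + (H14 t).mulVec θ) ⬝ᵥ x)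
        + ((H21 t).mulVec x + (H22 t).mulVec y + (H23 t).mulVec z + (H24 t).mulVec θ) ⬝ᵥ y
        + ((H31 t).mulVec x + (H32 t).mulVec y + (H33 t).mulVec z) ⬝ᵥ z
        + ((H41 t).mulVec x + (H42 t).mulVec y + (H44 t).mulVec θ) ⬝ᵥ θ
        ≤ -β * (x ⬝ᵥ x + y ⬝ᵥ y + z ⬝ᵥ z + θ ⬝ᵥ θ))
    (K : ℝ → ℝ → Matrix (Fin n) (Fin n) ℝ) (tb : ℝ → EReal)
    (htbT : ∀ ϱ : ℝ, tb ϱ < (T : EReal))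
    (hterm : ∀ ϱ : ℝ, K ϱ T = 0)
    (hcont : ∀ ϱ : ℝ, ContinuousOn (K ϱ) {t : ℝ | tb ϱ < (t : EReal) ∧ t ≤ T})
    (hode : ∀ ϱ t : ℝ, tb ϱ < (t : EReal) → t < T →
      HasDerivAt (K ϱ)
        (-(Ric H11 H12 H13 H14 H21 H22 H23 H24 H31 H32 H33 H41 H42 H44 ϱ t (K ϱ t))) t)
    (hpsd : ∀ ϱ t : ℝ, tb ϱ < (t : EReal) → t ≤ T → (K ϱ t).PosSemidef)
    (hblow : ∀ ϱ : ℝ, ⊥ < tb ϱ →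
      Tendsto (fun t => ‖K ϱ t‖) (nhdsWithin (tb ϱ).toReal (Set.Ioi (tb ϱ).toReal)) atTop) :
    ∀ ϱ₁ ϱ₂ : ℝ, ϱ₂ < ϱ₁ → ϱ₁ < 0 →
      tb ϱ₁ ≤ tb ϱ₂ ∧
      ∀ t : ℝ, tb ϱ₂ < (t : EReal) → t ≤ T →
        (K ϱ₁ t).PosSemidef ∧ (K ϱ₂ t - K ϱ₁ t).PosSemidef := by
  intro ϱ₁ ϱ₂ h21 h10
  have hs22 : ∀ t ≤ T, ∀ x, x ⬝ᵥ (H22 t *ᵥ x) ≤ 0 := by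
    intro t ht x
    have h := hmono t ht 0 x 0 0
    have hx : 0 ≤ x ⬝ᵥ x := by simpa using dotProduct_self_star_nonneg x
    simp at h
    rw [dotProduct_comm]
    nlinarith
  have hs33 : ∀ t ≤ T, ∀ x, x ⬝ᵥ (H33 t *ᵥ x) ≤ 0 := by
    intro t ht x
    have h := hmono t ht 0 0 x 0
    have hx : 0 ≤ x ⬝ᵥ x := by simpa using dotProduct_self_star_nonneg x
    simp at h
    rw [dotProduct_comm]
    nlinarith
  have hs44 : ∀ t ≤ T, ∀ x, x ⬝ᵥ (H44 t *ᵥ x) ≤ 0 := by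
    intro t ht x
    have h := hmono t ht 0 0 0 x
    have hx : 0 ≤ x ⬝ᵥ x := by simpa using dotProduct_self_star_nonneg x
    simp at h
    rw [dotProduct_comm]
    nlinarith
  have main : ∀ t : ℝ, tb ϱ₁ < (t : EReal) → tb ϱ₂ < (t : EReal) → t ≤ T →
      (K ϱ₂ t - K ϱ₁ t).PosSemidef := by
    intro a ha1 ha2 haT
    have hb1 : ∀ t ∈ Icc a T, tb ϱ₁ < (t : EReal) := fun t ht =>
      ha1.trans_le (EReal.coe_le_coe_iff.2 ht.1)
    have hb2 : ∀ t ∈ Icc a T, tb ϱ₂ < (t : EReal) := fun t ht =>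
      ha2.trans_le (EReal.coe_le_coe_iff.2 ht.1)
    have hp1 : ∀ t ∈ Icc a T, (K ϱ₁ t).PosSemidef := fun t ht => hpsd _ _ (hb1 t ht) ht.2
    have hp2 : ∀ t ∈ Icc a T, (K ϱ₂ t).PosSemidef := fun t ht => hpsd _ _ (hb2 t ht) ht.2
    have hk1 : ContinuousOn (K ϱ₁) (Icc a T) :=
      (hcont ϱ₁).mono (fun t ht => ⟨hb1 t ht, ht.2⟩)
    have hk2 : ContinuousOn (K ϱ₂) (Icc a T) :=
      (hcont ϱ₂).mono (fun t ht => ⟨hb2 t ht, ht.2⟩)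
    refine aux_comp (a := a) (T := T) (fun t => K ϱ₂ t - K ϱ₁ t)
      (fun t => Ric H11 H12 H13 H14 H21 H22 H23 H24 H31 H32 H33 H41 H42 H44 ϱ₂ t (K ϱ₂ t) -
        Ric H11 H12 H13 H14 H21 H22 H23 H24 H31 H32 H33 H41 H42 H44 ϱ₁ t (K ϱ₁ t))
      (fun t => (2 : ℝ) • H21 t + ϱ₁ • (H22 t * (K ϱ₁ t + K ϱ₂ t))
        + ϱ₁ ^ 2 • qF (K ϱ₁ t) (K ϱ₂ t) (H33 t) (H31 t) (H32 t)
        + ϱ₁ ^ 2 • qF (K ϱ₁ t) (K ϱ₂ t) (H44 t) (H41 t) (H42 t))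
      (hk2.sub hk1) ?_ (by simp [hterm]) ?_ ?_ ?_ a ⟨le_rfl, haT⟩
    · refine (((hc21.continuousOn.const_smul (2 : ℝ)).add
        ((aux_mul hc22.continuousOn (hk1.add hk2)).const_smul ϱ₁)).add
        ((aux_qFc hk1 hk2 hc33.continuousOn hc31.continuousOn hc32.continuousOn hp1 hp2
          (fun t _ => (hsym t).2.2.2.2.2.2.2.1) (fun t ht => hs33 t ht.2)).const_smul (ϱ₁ ^ 2))).add
        ((aux_qFc hk1 hk2 hc44.continuousOn hc41.continuousOn hc42.continuousOn hp1 hp2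
          (fun t _ => (hsym t).2.2.2.2.2.2.2.2) (fun t ht => hs44 t ht.2)).const_smul (ϱ₁ ^ 2))
    · intro t ht
      rw [transpose_sub, aux_tr (hp1 t ht), aux_tr (hp2 t ht)]
    · intro t ht htT
      refine ((hode ϱ₂ t (hb2 t ht) htT).sub (hode ϱ₁ t (hb1 t ht) htT)).congr_deriv ?_
      abel
    · intro t ht δ hδ v hD hv
      obtain ⟨h11, h12, h13, h14, h22, h23, h24, h33, h44⟩ := hsym t
      have k1 := hp1 t ht
      have k2 := hp2 t ht
      have t3 := aux_term (L := H31 t) (M := H32 t) k1 k2 h33 (hs33 t ht.2) δ v hD hv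
      have t4 := aux_term (L := H41 t) (M := H42 t) k1 k2 h44 (hs44 t ht.2) δ v hD hv
      have f3 := aux_Fnn k2 h33 (hs33 t ht.2) ((H31 t + H32 t * K ϱ₂ t) *ᵥ v)
      have f4 := aux_Fnn k2 h44 (hs44 t ht.2) ((H41 t + H42 t * K ϱ₂ t) *ᵥ v)
      have f2 := hs22 t ht.2 (K ϱ₂ t *ᵥ v)
      have hu : K ϱ₂ t *ᵥ v = K ϱ₁ t *ᵥ v - δ • v := by
        rw [sub_mulVec, neg_smul] at hv
        rw [sub_eq_add_neg, ← hv]; abel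
      have t2 : (K ϱ₂ t *ᵥ v) ⬝ᵥ (H22 t *ᵥ (K ϱ₂ t *ᵥ v))
          - (K ϱ₁ t *ᵥ v) ⬝ᵥ (H22 t *ᵥ (K ϱ₁ t *ᵥ v))
          = -δ * (v ⬝ᵥ ((H22 t * (K ϱ₁ t + K ϱ₂ t)) *ᵥ v)) := by
        have s1 := aux_symm h22 (K ϱ₁ t *ᵥ v) v
        rw [← mulVec_mulVec, add_mulVec, hu]
        simp only [mulVec_sub, mulVec_add, mulVec_smul, sub_dotProduct, dotProduct_sub,
          dotProduct_add, dotProduct_smul, smul_dotProduct, smul_eq_mul] at *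
        rw [s1]; ring
      have t1 : (K ϱ₂ t *ᵥ v) ⬝ᵥ (H21 t *ᵥ v) - (K ϱ₁ t *ᵥ v) ⬝ᵥ (H21 t *ᵥ v)
          = -δ * (v ⬝ᵥ (H21 t *ᵥ v)) := by
        rw [hu, sub_dotProduct, smul_dotProduct, smul_eq_mul]; ring
      rw [sub_mulVec, dotProduct_sub, aux_ric _ _ _ _ _ _ _ _ _ _ _ _ _ _ _ _ _ k1 h12 h13 h14 h23 h24,
        aux_ric _ _ _ _ _ _ _ _ _ _ _ _ _ _ _ _ _ k2 h12 h13 h14 h23 h24]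
      simp only [add_mulVec (_ + _), add_mulVec (_ • _), smul_mulVec, dotProduct_add,
        dotProduct_smul, smul_eq_mul]
      have hsq : 0 ≤ ϱ₂ ^ 2 - ϱ₁ ^ 2 := by nlinarith
      have p2 := mul_nonneg_of_nonpos_of_nonpos (sub_nonpos.2 h21.le) f2
      have p3 := mul_nonneg hsq f3
      have p4 := mul_nonneg hsq f4
      have q3 := mul_le_mul_of_nonneg_left t3 (sq_nonneg ϱ₁)
      have q4 := mul_le_mul_of_nonneg_left t4 (sq_nonneg ϱ₁)
      have q2 := congrArg (ϱ₁ * ·) t2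
      clear t2 t3 t4 f2 f3 f4 hD hv hu
      linarith
  have htb : tb ϱ₁ ≤ tb ϱ₂ := by
    by_contra! hlt
    have hbot : ⊥ < tb ϱ₁ := bot_le.trans_lt hlt
    have htop : tb ϱ₁ ≠ ⊤ := ((htbT ϱ₁).trans (EReal.coe_lt_top T)).ne
    have hbl := hblow ϱ₁ hbot
    obtain ⟨r, hr⟩ : ∃ r : ℝ, (r : EReal) = tb ϱ₁ := ⟨_, EReal.coe_toReal htop hbot.ne'⟩
    rw [← hr, EReal.toReal_coe] at hbl
    have hrT : r < T := by
      have := htbT ϱ₁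
      rw [← hr] at this
      exact_mod_cast this
    have hk2 : ContinuousOn (K ϱ₂) (Icc r T) := (hcont ϱ₂).mono (fun t ht =>
      ⟨hlt.trans_le (by rw [← hr]; exact EReal.coe_le_coe_iff.2 ht.1), ht.2⟩)
    obtain ⟨M, hM⟩ := isCompact_Icc.exists_bound_of_continuousOn hk2
    obtain ⟨t, ht1, ht2⟩ := ((hbl.eventually_gt_atTop M).and (Ioc_mem_nhdsGT hrT)).exists
    have hb1 : tb ϱ₁ < (t : EReal) := by rw [← hr]; exact EReal.coe_lt_coe_iff.2 ht2.1
    have h1 := aux_norm (hpsd ϱ₁ t hb1 ht2.2) (main t hb1 (hlt.trans hb1) ht2.2)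
    have h2 := hM t ⟨ht2.1.le, ht2.2⟩
    linarith
  exact ⟨htb, fun t ht htT => ⟨hpsd ϱ₁ t (htb.trans_lt ht) htT,
    main t (htb.trans_lt ht) ht htT⟩⟩
end

section
/- The blow-up time of the Riccati equation satisfies the two limits: lim_{ϱ → −∞} t_ϱ = T and lim_{ϱ ↑ 0} t_ϱ = −∞ (i.e. for every t̃ < T there exists ϱ̃ < 0 such that t_ϱ > t̃ for all ϱ < ϱ̃, and for every M > 0 there exists ε > 0 such that t_ϱ < −M for all ϱ ∈ (−ε, 0)). -/
open Filter Matrix Set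

attribute [local instance] Matrix.normedAddCommGroup Matrix.normedSpace

lemma F_quad {n : ℕ} {β : ℝ} {K N : Matrix (Fin n) (Fin n) ℝ} (hβ : 0 < β)
    (hK : K.PosSemidef) (hNs : Nᵀ = N)
    (hN : ∀ x : Fin n → ℝ, N.mulVec x ⬝ᵥ x ≤ -β * (x ⬝ᵥ x)) :
    ((1 - K * N)⁻¹ * K).IsHermitian ∧ ∀ x : Fin n → ℝ,
      β * (((1 - K * N)⁻¹ * K).mulVec x ⬝ᵥ ((1 - K * N)⁻¹ * K).mulVec x)
        ≤ x ⬝ᵥ ((1 - K * N)⁻¹ * K).mulVec x := by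
  have hKs : Kᵀ = K := by
    have := hK.1
    rwa [Matrix.IsHermitian, conjTranspose_eq_transpose_of_trivial] at this
  by_cases hu : IsUnit (1 - K * N).det
  · have hut : IsUnit ((1 - K * N)ᵀ).det := by rwa [det_transpose]
    have hMt : (1 - K * N)ᵀ = 1 - N * K := by
      rw [transpose_sub, transpose_mul, hKs, hNs, transpose_one]
    have hF : (1 - K * N)⁻¹ * K = K * ((1 - K * N)ᵀ)⁻¹ := by
      have h1 : (1 - K * N) * K = K * (1 - K * N)ᵀ := by
        rw [hMt]; noncomm_ring
      calc (1 - K * N)⁻¹ * K = (1 - K * N)⁻¹ * (K * ((1 - K * N)ᵀ * ((1 - K * N)ᵀ)⁻¹)) := by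
            rw [mul_nonsing_inv _ hut, mul_one]
        _ = (1 - K * N)⁻¹ * ((K * (1 - K * N)ᵀ) * ((1 - K * N)ᵀ)⁻¹) := by
            simp only [mul_assoc]
        _ = ((1 - K * N)⁻¹ * (1 - K * N)) * K * ((1 - K * N)ᵀ)⁻¹ := by
            rw [← h1]; simp only [mul_assoc]
        _ = _ := by rw [nonsing_inv_mul _ hu, one_mul]
    refine ⟨?_, fun x => ?_⟩
    · rw [Matrix.IsHermitian, conjTranspose_eq_transpose_of_trivial, transpose_mul, hKs,
        transpose_nonsing_inv, ← hF]
    · rw [hF]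
      obtain ⟨y, hy⟩ : ∃ y, y = ((1 - K * N)ᵀ)⁻¹.mulVec x := ⟨_, rfl⟩
      have hx : x = y - N.mulVec (K.mulVec y) := by
        have : (1 - K * N)ᵀ.mulVec y = x := by
          rw [hy, mulVec_mulVec, mul_nonsing_inv _ hut, one_mulVec]
        rw [← this, hMt, sub_mulVec, one_mulVec, mulVec_mulVec]
      rw [← mulVec_mulVec, ← hy]
      conv_rhs => rw [hx]
      have h1 := hN (K.mulVec y)
      have h2 := hK.dotProduct_mulVec_nonneg y
      simp only [star_trivial] at h2
      rw [sub_dotProduct]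
      linarith
  · rw [nonsing_inv_apply_not_isUnit _ hu]
    simp

lemma F_psd {n : ℕ} {β : ℝ} {K N : Matrix (Fin n) (Fin n) ℝ} (hβ : 0 < β)
    (hK : K.PosSemidef) (hNs : Nᵀ = N)
    (hN : ∀ x : Fin n → ℝ, N.mulVec x ⬝ᵥ x ≤ -β * (x ⬝ᵥ x)) :
    ((1 - K * N)⁻¹ * K).PosSemidef := by
  obtain ⟨h1, h2⟩ := F_quad hβ hK hNs hN
  refine PosSemidef.of_dotProduct_mulVec_nonneg h1 fun x => ?_
  rw [star_trivial]
  refine le_trans ?_ (h2 x)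
  have : 0 ≤ ((1 - K * N)⁻¹ * K).mulVec x ⬝ᵥ ((1 - K * N)⁻¹ * K).mulVec x :=
    Finset.sum_nonneg fun i _ => mul_self_nonneg _
  positivity

lemma quad_single {n : ℕ} (K : Matrix (Fin n) (Fin n) ℝ) (i j : Fin n) :
    Pi.single i (1 : ℝ) ⬝ᵥ K.mulVec (Pi.single j 1) = K i j := by
  simp

lemma psd_norm_le_trace {n : ℕ} {K : Matrix (Fin n) (Fin n) ℝ} (hK : K.PosSemidef) :
    ‖K‖ ≤ K.trace := by
  have hd : ∀ i, 0 ≤ K i i := fun i => hK.diag_nonneg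
  have htr : ∀ i, K i i ≤ K.trace := fun i =>
    Finset.single_le_sum (f := fun i => K i i) (fun i _ => hd i) (Finset.mem_univ i)
  have h0 : 0 ≤ K.trace := Finset.sum_nonneg fun i _ => hd i
  rw [Matrix.norm_le_iff h0]
  intro i j
  have hs : K j i = K i j := by have := hK.1.apply i j; simpa using this
  have h1 := hK.dotProduct_mulVec_nonneg (Pi.single i 1 + Pi.single j 1)
  have h2 := hK.dotProduct_mulVec_nonneg (Pi.single i 1 - Pi.single j 1)
  simp only [star_trivial, mulVec_add, mulVec_sub, add_dotProduct, sub_dotProduct,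
    dotProduct_add, dotProduct_sub, quad_single] at h1 h2
  rw [Real.norm_eq_abs, abs_le]
  constructor <;> linarith [htr i, htr j]

lemma F_norm {n : ℕ} {β : ℝ} {K N : Matrix (Fin n) (Fin n) ℝ} (hβ : 0 < β)
    (hK : K.PosSemidef) (hNs : Nᵀ = N)
    (hN : ∀ x : Fin n → ℝ, N.mulVec x ⬝ᵥ x ≤ -β * (x ⬝ᵥ x)) :
    ‖(1 - K * N)⁻¹ * K‖ ≤ n / β := by
  have hp := F_psd hβ hK hNs hN
  obtain ⟨-, h2⟩ := F_quad hβ hK hNs hN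
  generalize (1 - K * N)⁻¹ * K = F at *
  refine (psd_norm_le_trace hp).trans ?_
  have : ∀ i, F i i ≤ 1 / β := by
    intro i
    have h := h2 (Pi.single i 1)
    rw [quad_single] at h
    have h3 : F i i * F i i ≤ F.mulVec (Pi.single i 1) ⬝ᵥ F.mulVec (Pi.single i 1) := by
      have := Finset.single_le_sum (f := fun j => F.mulVec (Pi.single i 1) j * F.mulVec (Pi.single i 1) j)
        (fun j _ => mul_self_nonneg _) (Finset.mem_univ i)
      simpa [dotProduct] using this
    have h4 : 0 ≤ F i i := hp.diag_nonneg
    rw [le_div_iff₀ hβ]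
    by_contra hc
    push Not at hc
    have : 0 < F i i := by
      rcases h4.lt_or_eq with h | h
      · exact h
      · rw [← h] at hc; linarith
    nlinarith
  calc F.trace ≤ ∑ i : Fin n, 1 / β := Finset.sum_le_sum fun i _ => this i
    _ = n / β := by simp [div_eq_mul_inv]

lemma mnorm_mul_le {n : ℕ} (A B : Matrix (Fin n) (Fin n) ℝ) : ‖A * B‖ ≤ n * ‖A‖ * ‖B‖ := by
  rw [Matrix.norm_le_iff (by positivity)]
  intro i j
  rw [Matrix.mul_apply]
  calc ‖∑ k, A i k * B k j‖ ≤ ∑ k : Fin n, ‖A‖ * ‖B‖ := by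
        refine norm_sum_le_of_le _ fun k _ => ?_
        rw [norm_mul]
        exact mul_le_mul (Matrix.norm_entry_le_entrywise_sup_norm A)
          (Matrix.norm_entry_le_entrywise_sup_norm B) (norm_nonneg _) (norm_nonneg _)
    _ = _ := by simp [mul_assoc]

lemma norm_mul_le_of {n : ℕ} {A B : Matrix (Fin n) (Fin n) ℝ} {a b : ℝ}
    (ha : ‖A‖ ≤ a) (hb : ‖B‖ ≤ b) : ‖A * B‖ ≤ n * a * b := by
  refine (mnorm_mul_le A B).trans ?_
  have := (norm_nonneg A).trans ha
  gcongr

lemma quad_bound {n : ℕ} {P Q F K : Matrix (Fin n) (Fin n) ℝ}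
    {P' Q' : Matrix (Fin n) (Fin n) ℝ} {C w f : ℝ} (hC : 0 ≤ C) (hw : 1 ≤ w)
    (hP : ‖P‖ ≤ C) (hQ : ‖Q‖ ≤ C) (hP' : ‖P'‖ ≤ C) (hQ' : ‖Q'‖ ≤ C) (hF : ‖F‖ ≤ f)
    (hK : ‖K‖ ≤ w) :
    ‖(K * P + Q) * F * (Q' + P' * K)‖ ≤ n * (n * ((n + 1) * C) * f) * ((n + 1) * C) * w ^ 2 := by
  have h1 : ‖K * P + Q‖ ≤ (n + 1) * C * w := by
    refine (norm_add_le _ _).trans ?_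
    have := norm_mul_le_of hK hP
    nlinarith
  have h2 : ‖Q' + P' * K‖ ≤ (n + 1) * C * w := by
    refine (norm_add_le _ _).trans ?_
    have := norm_mul_le_of hP' hK
    nlinarith
  refine (norm_mul_le_of (norm_mul_le_of h1 hF) h2).trans (le_of_eq (by ring))

lemma trace_le_norm {n : ℕ} (A : Matrix (Fin n) (Fin n) ℝ) : A.trace ≤ n * ‖A‖ := by
  calc A.trace ≤ ∑ i : Fin n, ‖A‖ := Finset.sum_le_sum fun i _ =>
        (le_abs_self _).trans (Matrix.norm_entry_le_entrywise_sup_norm A)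
    _ = _ := by simp

lemma mem_dom {tb : EReal} {t0 t : ℝ} (h : tb < (t0 : EReal)) (ht : t0 ≤ t) :
    tb < (t : EReal) := h.trans_le (by exact_mod_cast ht)

lemma entry_deriv {n : ℕ} {K : ℝ → Matrix (Fin n) (Fin n) ℝ} {D : Matrix (Fin n) (Fin n) ℝ}
    {t : ℝ} (h : HasDerivAt K D t) (i j : Fin n) : HasDerivAt (fun s => K s i j) (D i j) t :=
  hasDerivAt_pi.1 (hasDerivAt_pi.1 h i) j

lemma trace_deriv {n : ℕ} {K : ℝ → Matrix (Fin n) (Fin n) ℝ} {D : Matrix (Fin n) (Fin n) ℝ}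
    {t : ℝ} (h : HasDerivAt K D t) : HasDerivAt (fun s => (K s).trace) D.trace t := by
  have := HasDerivAt.fun_sum (u := Finset.univ) (fun i _ => entry_deriv h i i)
  exact this

/-- upper comparison -/
lemma upper_cmp {w w' : ℝ → ℝ} {t0 T D ε : ℝ} (h0 : t0 ≤ T)
    (hc : ContinuousOn w (Icc t0 T)) (hd : ∀ t ∈ Ioo t0 T, HasDerivAt w (-(w' t)) t)
    (hw : ∀ t ∈ Icc t0 T, 1 ≤ w t) (hT : w T = 1) (hε : 0 ≤ ε)
    (hb : ∀ t ∈ Ioo t0 T, w' t ≤ D * w t + ε * D * w t ^ 2) :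
    Real.exp (-(D * (T - t0))) - ε ≤ (w t0)⁻¹ := by
  have hanti : AntitoneOn (fun t => ((w t)⁻¹ + ε) * Real.exp (-(D * t))) (Icc t0 T) := by
    have hder : ∀ t ∈ Ioo t0 T, HasDerivAt (fun t => ((w t)⁻¹ + ε) * Real.exp (-(D * t)))
        ((-(-(w' t)) / (w t) ^ 2) * Real.exp (-(D * t)) +
          ((w t)⁻¹ + ε) * (Real.exp (-(D * t)) * (-(D * 1)))) t := by
      intro t ht
      have hp := hw t (Ioo_subset_Icc_self ht)
      exact (((hd t ht).fun_inv (by positivity)).add_const ε).mul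
        (((hasDerivAt_id t).const_mul D).neg.exp)
    refine antitoneOn_of_deriv_nonpos (convex_Icc _ _) ?_ ?_ ?_
    · refine ContinuousOn.mul (ContinuousOn.add (hc.inv₀ fun t ht => ?_) continuousOn_const) ?_
      · have := hw t ht; positivity
      · fun_prop
    · rw [interior_Icc]
      exact fun t ht => (hder t ht).differentiableAt.differentiableWithinAt
    · rw [interior_Icc]
      intro t ht
      rw [(hder t ht).deriv]
      have hp := hw t (Ioo_subset_Icc_self ht)
      have hp0 : 0 < w t := by linarith
      have h1 : w' t / w t ^ 2 ≤ D * ((w t)⁻¹ + ε) := by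
        rw [div_le_iff₀ (by positivity)]
        have : D * ((w t)⁻¹ + ε) * w t ^ 2 = D * w t + ε * D * w t ^ 2 := by
          field_simp
        rw [this]; exact hb t ht
      rw [neg_neg]
      have h2 := Real.exp_pos (-(D * t))
      nlinarith
  have h := hanti (left_mem_Icc.2 h0) (right_mem_Icc.2 h0) h0
  simp only [hT] at h
  have he : Real.exp (-(D * T)) = Real.exp (-(D * (T - t0))) * Real.exp (-(D * t0)) := by
    rw [← Real.exp_add]; congr 1; ring
  rw [he, ← mul_assoc] at h
  have h3 := le_of_mul_le_mul_right h (Real.exp_pos _)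
  have h4 := Real.exp_pos (-(D * (T - t0)))
  norm_num at h3
  nlinarith

/-- lower comparison -/
lemma lower_cmp {k k' : ℝ → ℝ} {t0 T b r : ℝ} (h0 : t0 ≤ T)
    (hc : ContinuousOn k (Icc t0 T)) (hd : ∀ t ∈ Ioo t0 T, HasDerivAt k (-(k' t)) t)
    (hT : k T = 0) (hr : 0 < r)
    (hb : ∀ t ∈ Ioo t0 T, b * (1 + (r * k t) ^ 2) ≤ k' t) :
    r * b * (T - t0) < Real.pi / 2 := by
  have hanti : AntitoneOn (fun t => Real.arctan (r * k t) + r * b * t) (Icc t0 T) := by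
    have hder : ∀ t ∈ Ioo t0 T, HasDerivAt (fun t => Real.arctan (r * k t) + r * b * t)
        ((1 / (1 + (r * k t) ^ 2)) * (r * (-(k' t))) + r * b * 1) t := by
      intro t ht
      exact (((hd t ht).const_mul r).arctan).add ((hasDerivAt_id t).const_mul (r * b))
    refine antitoneOn_of_deriv_nonpos (convex_Icc _ _) ?_ ?_ ?_
    · refine ContinuousOn.add (Real.continuous_arctan.comp_continuousOn
        (continuousOn_const.mul hc)) ?_
      fun_prop
    · rw [interior_Icc]
      exact fun t ht => (hder t ht).differentiableAt.differentiableWithinAt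
    · rw [interior_Icc]
      intro t ht
      rw [(hder t ht).deriv]
      have h1 : b ≤ k' t / (1 + (r * k t) ^ 2) := by
        rw [le_div_iff₀ (by positivity)]; exact hb t ht
      have : 1 / (1 + (r * k t) ^ 2) * (r * -k' t) + r * b * 1
        = r * (b - k' t / (1 + (r * k t) ^ 2)) := by ring
      rw [this]
      nlinarith
  have h := hanti (left_mem_Icc.2 h0) (right_mem_Icc.2 h0) h0
  simp only [hT, mul_zero, Real.arctan_zero] at h
  have := Real.arctan_lt_pi_div_two (r * k t0)
  linarith

lemma am_gm {a x y : ℝ} (ha : 0 < a) : -(a * x ^ 2 + y ^ 2 / a) ≤ 2 * (y * x) := by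
  have : 0 ≤ (a * x + y) ^ 2 / a := by positivity
  have e : (a * x + y) ^ 2 / a = a * x ^ 2 + 2 * (y * x) + y ^ 2 / a := by
    field_simp
    ring
  linarith

/-- diagonal lower bound of the principal part -/
lemma diag_lower {n : ℕ} {β a C : ℝ} {K A N : Matrix (Fin n) (Fin n) ℝ} (ha : 0 < a)
    (hKs : Kᵀ = K) (hA : ‖A‖ ≤ C) (i : Fin n)
    (hN : ∀ x : Fin n → ℝ, N.mulVec x ⬝ᵥ x ≤ -β * (x ⬝ᵥ x)) {r : ℝ} (hr : 0 ≤ r)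
    (har : 2 * a = r * β) :
    a * (K i i) ^ 2 - n * (C ^ 2 / a) ≤
      (K * Aᵀ) i i + (A * K) i i + ((-r) • (K * N * K)) i i := by
  have hsym : ∀ j, K i j = K j i := fun j => by
    conv_lhs => rw [← hKs]
    rfl
  have e1 : (K * Aᵀ) i i = (A * K) i i := by
    have : (K * Aᵀ) = (A * K)ᵀ := by rw [transpose_mul, hKs]
    rw [this]; rfl
  have e2 : (A * K) i i = ∑ j, A i j * K j i := Matrix.mul_apply
  have h3 : (K * N * K) i i ≤ -β * ∑ j, K j i ^ 2 := by
    have h := hN (fun j => K j i)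
    have e : (K * N * K) i i = N.mulVec (fun j => K j i) ⬝ᵥ (fun j => K j i) := by
      rw [mul_assoc, Matrix.mul_apply, dotProduct]
      refine Finset.sum_congr rfl fun j _ => ?_
      rw [hsym, mul_comm]; rfl
    rw [e]
    refine h.trans (le_of_eq ?_)
    simp [dotProduct, sq]
  have h4 : -(a * ∑ j, K j i ^ 2 + n * (C ^ 2 / a)) ≤ 2 * ∑ j, A i j * K j i := by
    have : ∀ j, -(a * K j i ^ 2 + C ^ 2 / a) ≤ 2 * (A i j * K j i) := by
      intro j
      refine le_trans ?_ (am_gm ha)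
      have hAj : |A i j| ≤ C := (Matrix.norm_entry_le_entrywise_sup_norm A).trans hA
      have : A i j ^ 2 ≤ C ^ 2 := sq_le_sq' (by linarith [abs_le.1 hAj]) (abs_le.1 hAj).2
      gcongr
    have hs := Finset.sum_le_sum (s := Finset.univ) fun j _ => this j
    rw [← Finset.mul_sum, Finset.sum_neg_distrib, Finset.sum_add_distrib, ← Finset.mul_sum] at hs
    simpa using hs
  have h5 : K i i ^ 2 ≤ ∑ j, K j i ^ 2 :=
    Finset.single_le_sum (f := fun j => K j i ^ 2) (fun j _ => sq_nonneg _) (Finset.mem_univ i)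
  rw [e1, e2, Matrix.smul_apply, smul_eq_mul]
  have h6 : r * (K * N * K) i i ≤ r * (-β * ∑ j, K j i ^ 2) := mul_le_mul_of_nonneg_left h3 hr
  have h7 : r * (-β * ∑ j, K j i ^ 2) = -(2 * a) * ∑ j, K j i ^ 2 := by rw [har]; ring
  have h8 : a * K i i ^ 2 ≤ a * ∑ j, K j i ^ 2 := mul_le_mul_of_nonneg_left h5 ha.le
  linarith

set_option maxHeartbeats 4000000

/-- `t_ϱ → T` as `ϱ → −∞` and `t_ϱ → −∞` as `ϱ ↑ 0`. -/
theorem stmt_10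
    (T : ℝ) (hT : 0 < T) (n : ℕ) (hn : 1 ≤ n) (β : ℝ) (hβ : 0 < β)
    (H11 H12 H13 H14 H21 H22 H23 H24 H31 H32 H33 H41 H42 H44 :
      ℝ → Matrix (Fin n) (Fin n) ℝ)
    (hc11 : Continuous H11) (hc12 : Continuous H12) (hc13 : Continuous H13)
    (hc14 : Continuous H14) (hc21 : Continuous H21) (hc22 : Continuous H22)
    (hc23 : Continuous H23) (hc24 : Continuous H24) (hc31 : Continuous H31)
    (hc32 : Continuous H32) (hc33 : Continuous H33) (hc41 : Continuous H41)
    (hc42 : Continuous H42) (hc44 : Continuous H44)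
    (hsym : ∀ t : ℝ, (H11 t)ᵀ = H11 t ∧ (H12 t)ᵀ = H21 t ∧ (H13 t)ᵀ = H31 t ∧
      (H14 t)ᵀ = H41 t ∧ (H22 t)ᵀ = H22 t ∧ (H23 t)ᵀ = H32 t ∧
      (H24 t)ᵀ = H42 t ∧ (H33 t)ᵀ = H33 t ∧ (H44 t)ᵀ = H44 t)
    (hconst : ∀ t : ℝ, t ≤ 0 → H11 t = H11 0 ∧ H12 t = H12 0 ∧ H13 t = H13 0 ∧
      H14 t = H14 0 ∧ H21 t = H21 0 ∧ H22 t = H22 0 ∧ H23 t = H23 0 ∧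
      H24 t = H24 0 ∧ H31 t = H31 0 ∧ H32 t = H32 0 ∧ H33 t = H33 0 ∧
      H41 t = H41 0 ∧ H42 t = H42 0 ∧ H44 t = H44 0)
    (hmono : ∀ t : ℝ, t ≤ T → ∀ x y z θ : Fin n → ℝ,
      -(((H11 t).mulVec x + (H12 t).mulVec y + (H13 t).mulVec z + (H14 t).mulVec θ) ⬝ᵥ x)
        + ((H21 t).mulVec x + (H22 t).mulVec y + (H23 t).mulVec z + (H24 t).mulVec θ) ⬝ᵥ y
        + ((H31 t).mulVec x + (H32 t).mulVec y + (H33 t).mulVec z) ⬝ᵥ z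
        + ((H41 t).mulVec x + (H42 t).mulVec y + (H44 t).mulVec θ) ⬝ᵥ θ
        ≤ -β * (x ⬝ᵥ x + y ⬝ᵥ y + z ⬝ᵥ z + θ ⬝ᵥ θ))
    (K : ℝ → ℝ → Matrix (Fin n) (Fin n) ℝ) (tb : ℝ → EReal)
    (htbT : ∀ ϱ : ℝ, tb ϱ < (T : EReal))
    (hterm : ∀ ϱ : ℝ, K ϱ T = 0)
    (hcont : ∀ ϱ : ℝ, ContinuousOn (K ϱ) {t : ℝ | tb ϱ < (t : EReal) ∧ t ≤ T})
    (hode : ∀ ϱ t : ℝ, tb ϱ < (t : EReal) → t < T →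
      HasDerivAt (K ϱ)
        (-(Ric H11 H12 H13 H14 H21 H22 H23 H24 H31 H32 H33 H41 H42 H44 ϱ t (K ϱ t))) t)
    (hpsd : ∀ ϱ t : ℝ, tb ϱ < (t : EReal) → t ≤ T → (K ϱ t).PosSemidef)
    (hblow : ∀ ϱ : ℝ, ⊥ < tb ϱ →
      Tendsto (fun t => ‖K ϱ t‖) (nhdsWithin (tb ϱ).toReal (Set.Ioi (tb ϱ).toReal)) atTop) :
    Tendsto tb atBot (nhds (T : EReal)) ∧
    Tendsto tb (nhdsWithin 0 (Set.Iio 0)) (nhds (⊥ : EReal)) := by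
  have hN22 : ∀ t ≤ T, ∀ x : Fin n → ℝ, (H22 t).mulVec x ⬝ᵥ x ≤ -β * (x ⬝ᵥ x) := by
    intro t ht x
    simpa using hmono t ht 0 x 0 0
  have hN33 : ∀ t ≤ T, ∀ x : Fin n → ℝ, (H33 t).mulVec x ⬝ᵥ x ≤ -β * (x ⬝ᵥ x) := by
    intro t ht x
    simpa using hmono t ht 0 0 x 0
  have hN44 : ∀ t ≤ T, ∀ x : Fin n → ℝ, (H44 t).mulVec x ⬝ᵥ x ≤ -β * (x ⬝ᵥ x) := by
    intro t ht x
    simpa using hmono t ht 0 0 0 x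
  have hN11 : ∀ t ≤ T, ∀ i, β ≤ H11 t i i := by
    intro t ht i
    have := hmono t ht (Pi.single i 1) 0 0 0
    simp at this
    linarith
  have hKs : ∀ M : Matrix (Fin n) (Fin n) ℝ, M.PosSemidef → Mᵀ = M := by
    intro M hM
    have := hM.1
    rwa [Matrix.IsHermitian, conjTranspose_eq_transpose_of_trivial] at this
  have hbd : ∀ t0 : ℝ, ∃ C : ℝ, 0 ≤ C ∧ ∀ t ∈ Icc t0 T, ‖H11 t‖ ≤ C ∧ ‖H12 t‖ ≤ C ∧
      ‖H13 t‖ ≤ C ∧ ‖H14 t‖ ≤ C ∧ ‖H21 t‖ ≤ C ∧ ‖H22 t‖ ≤ C ∧ ‖H23 t‖ ≤ C ∧ ‖H24 t‖ ≤ C ∧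
      ‖H31 t‖ ≤ C ∧ ‖H32 t‖ ≤ C ∧ ‖H41 t‖ ≤ C ∧ ‖H42 t‖ ≤ C := by
    intro t0
    have one : ∀ H : ℝ → Matrix (Fin n) (Fin n) ℝ, Continuous H →
        ∃ C : ℝ, ∀ t ∈ Icc t0 T, ‖H t‖ ≤ C := fun H hH =>
      isCompact_Icc.exists_bound_of_continuousOn hH.continuousOn
    obtain ⟨c1, h1⟩ := one _ hc11
    obtain ⟨c2, h2⟩ := one _ hc12
    obtain ⟨c3, h3⟩ := one _ hc13
    obtain ⟨c4, h4⟩ := one _ hc14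
    obtain ⟨c5, h5⟩ := one _ hc21
    obtain ⟨c6, h6⟩ := one _ hc22
    obtain ⟨c7, h7⟩ := one _ hc23
    obtain ⟨c8, h8⟩ := one _ hc24
    obtain ⟨c9, h9⟩ := one _ hc31
    obtain ⟨d1, g1⟩ := one _ hc32
    obtain ⟨d2, g2⟩ := one _ hc41
    obtain ⟨d3, g3⟩ := one _ hc42
    have a : ∀ x : ℝ, 0 ≤ |x| ∧ x ≤ |x| := fun x => ⟨abs_nonneg x, le_abs_self x⟩
    have a1 := a c1
    have a2 := a c2
    have a3 := a c3
    have a4 := a c4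
    have a5 := a c5
    have a6 := a c6
    have a7 := a c7
    have a8 := a c8
    have a9 := a c9
    have b1 := a d1
    have b2 := a d2
    have b3 := a d3
    refine ⟨|c1| + |c2| + |c3| + |c4| + |c5| + |c6| + |c7| + |c8| + |c9| + |d1| + |d2| + |d3|,
      by positivity, fun t ht => ⟨(h1 t ht).trans ?_, (h2 t ht).trans ?_, (h3 t ht).trans ?_,
      (h4 t ht).trans ?_, (h5 t ht).trans ?_, (h6 t ht).trans ?_, (h7 t ht).trans ?_,
      (h8 t ht).trans ?_, (h9 t ht).trans ?_, (g1 t ht).trans ?_, (g2 t ht).trans ?_,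
      (g3 t ht).trans ?_⟩⟩ <;> linarith
  constructor
  · rw [tendsto_order]
    refine ⟨fun a ha => ?_, fun a ha => Eventually.of_forall fun ϱ => (htbT ϱ).trans ha⟩
    obtain ⟨t0, hat, ht0⟩ := EReal.lt_iff_exists_real_btwn.1 ha
    have ht0T : t0 < T := by exact_mod_cast ht0
    obtain ⟨C, hC0, hC⟩ := hbd t0
    have hpos : 0 < T - t0 := sub_pos.2 ht0T
    -- thresholds
    filter_upwards [eventually_lt_atBot (0 : ℝ),
      eventually_le_atBot (-(4 * n * C ^ 2 / β ^ 2)),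
      eventually_le_atBot (-((Real.pi / (β * (T - t0))) ^ 2))] with ϱ hneg h1 h2
    refine lt_of_lt_of_le hat ?_
    by_contra hlt
    push Not at hlt
    set i : Fin n := ⟨0, hn⟩
    set r : ℝ := -ϱ with hr
    have hrpos : 0 < r := by linarith
    have hsub : Icc t0 T ⊆ {t : ℝ | tb ϱ < (t : EReal) ∧ t ≤ T} :=
      fun t ht => ⟨mem_dom hlt ht.1, ht.2⟩
    have hsq : 0 < Real.sqrt r := Real.sqrt_pos.2 hrpos
    have key := lower_cmp (k := fun t => K ϱ t i i)
      (k' := fun t => Ric H11 H12 H13 H14 H21 H22 H23 H24 H31 H32 H33 H41 H42 H44 ϱ t (K ϱ t) i i)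
      (t0 := t0) (T := T) (b := β / 2) (r := Real.sqrt r) ht0T.le
      (continuousOn_pi.1 (continuousOn_pi.1 ((hcont ϱ).mono hsub) i) i)
      (fun t ht => entry_deriv (hode ϱ t (mem_dom hlt ht.1.le) ht.2) i i)
      (by simp [hterm]) hsq ?_
    · have h3 : Real.pi / (β * (T - t0)) ≤ Real.sqrt r := Real.le_sqrt_of_sq_le (by linarith)
      rw [div_le_iff₀ (by positivity)] at h3
      linarith
    · intro t ht
      have hP := hpsd ϱ t (mem_dom hlt ht.1.le) ht.2.le
      obtain ⟨s11, s12, s13, s14, s22, s23, s24, s33, s44⟩ := hsym t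
      have hs := hKs _ hP
      have b12 := (hC t (Ioo_subset_Icc_self ht)).2.1
      have p1 := F_psd hβ hP s33 (hN33 t ht.2.le)
      have p2 := F_psd hβ hP s44 (hN44 t ht.2.le)
      have q1 := p1.mul_mul_conjTranspose_same (K ϱ t * H23 t + H13 t)
      have q2 := p2.mul_mul_conjTranspose_same (K ϱ t * H24 t + H14 t)
      rw [conjTranspose_eq_transpose_of_trivial, transpose_add, transpose_mul, hs, s23, s13,
        add_comm (H32 t * _)] at q1
      rw [conjTranspose_eq_transpose_of_trivial, transpose_add, transpose_mul, hs, s24, s14,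
        add_comm (H42 t * _)] at q2
      have d1 := q1.diag_nonneg (i := i)
      have d2 := q2.diag_nonneg (i := i)
      have hd := diag_lower (β := β) (a := r * β / 2) (C := C) (K := K ϱ t) (A := H12 t)
        (N := H22 t) (by positivity) hs b12 i (hN22 t ht.2.le) (r := r) hrpos.le (by ring)
      rw [s12, hr, neg_neg, ← hr] at hd
      have h11 := hN11 t ht.2.le i
      have hsm : (n : ℝ) * (C ^ 2 / (r * β / 2)) ≤ β / 2 := by
        have : 4 * n * C ^ 2 / β ^ 2 ≤ r := by linarith
        rw [div_le_iff₀ (by positivity)] at this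
        rw [← mul_div_assoc, div_le_iff₀ (by positivity)]
        nlinarith
      have e1 := mul_nonneg (sq_nonneg ϱ) d1
      have e2 := mul_nonneg (sq_nonneg ϱ) d2
      have hsq2 : Real.sqrt r ^ 2 = r := Real.sq_sqrt hrpos.le
      simp only [Ric, Matrix.add_apply, Matrix.smul_apply, smul_eq_mul] at hd e1 e2 ⊢
      rw [mul_pow, hsq2]
      linarith
  · rw [EReal.tendsto_nhds_bot_iff_real]
    intro x
    obtain ⟨m, hmx, hmT⟩ : ∃ m : ℝ, m < x ∧ m < T :=
      ⟨min x T - 1, by linarith [min_le_left x T], by linarith [min_le_right x T]⟩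
    obtain ⟨C, hC0, hC⟩ := hbd m
    obtain ⟨D1, hD1⟩ : ∃ D : ℝ, D = (n : ℝ) * (n * ((n + 1) * C) * (n / β)) * ((n + 1) * C) :=
      ⟨_, rfl⟩
    have hD10 : 0 ≤ D1 := by rw [hD1]; positivity
    obtain ⟨D, hD⟩ : ∃ D : ℝ, D = n * (2 * (n * C) + C + n * (n * C) + 2 * D1) := ⟨_, rfl⟩
    have hD0 : 0 ≤ D := by rw [hD]; positivity
    obtain ⟨δ, hδ⟩ : ∃ δ : ℝ, δ = Real.exp (-(D * (T - m))) := ⟨_, rfl⟩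
    have hδ0 : 0 < δ := by rw [hδ]; exact Real.exp_pos _
    have hev : ∀ᶠ ϱ : ℝ in nhdsWithin 0 (Iio 0), -(min 1 (δ / 2)) < ϱ ∧ ϱ < 0 := by
      have : 0 < min 1 (δ / 2) := by positivity
      exact Ioo_mem_nhdsLT (by linarith)
    filter_upwards [hev] with ϱ hϱ
    obtain ⟨hϱ1, hϱ2⟩ := hϱ
    have hε1 : |ϱ| ≤ 1 := by
      rw [abs_of_neg hϱ2]; linarith [min_le_left 1 (δ / 2)]
    have hε2 : |ϱ| ≤ δ / 2 := by
      rw [abs_of_neg hϱ2]; linarith [min_le_right 1 (δ / 2)]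
    have bound : ∀ t0, m ≤ t0 → t0 ≤ T → tb ϱ < (t0 : EReal) → ‖K ϱ t0‖ ≤ 2 / δ := by
      intro t0 hm0 h0T hlt
      have hsub : Icc t0 T ⊆ {t : ℝ | tb ϱ < (t : EReal) ∧ t ≤ T} :=
        fun t ht => ⟨mem_dom hlt ht.1, ht.2⟩
      have hP : ∀ t ∈ Icc t0 T, (K ϱ t).PosSemidef := fun t ht =>
        hpsd ϱ t (mem_dom hlt ht.1) ht.2
      have hw : ∀ t ∈ Icc t0 T, 1 ≤ 1 + (K ϱ t).trace := fun t ht => by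
        have := (norm_nonneg _).trans (psd_norm_le_trace (hP t ht))
        linarith
      have htc : ContinuousOn (fun t => 1 + (K ϱ t).trace) (Icc t0 T) := by
        have hk := (hcont ϱ).mono hsub
        refine continuousOn_const.add ?_
        have : ContinuousOn (fun t => ∑ i, K ϱ t i i) (Icc t0 T) :=
          continuousOn_finset_sum _ fun i _ => continuousOn_pi.1 (continuousOn_pi.1 hk i) i
        exact this
      have key := upper_cmp (w := fun t => 1 + (K ϱ t).trace)
        (w' := fun t =>
          (Ric H11 H12 H13 H14 H21 H22 H23 H24 H31 H32 H33 H41 H42 H44 ϱ t (K ϱ t)).trace)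
        (t0 := t0) (T := T) (D := D) (ε := |ϱ|) h0T htc
        (fun t ht => by
          have := (trace_deriv (hode ϱ t (mem_dom hlt ht.1.le) ht.2)).const_add 1
          rwa [trace_neg] at this)
        hw (by simp [hterm]) (abs_nonneg _) ?_
      · have hwt := hw t0 (left_mem_Icc.2 h0T)
        have hle : δ ≤ Real.exp (-(D * (T - t0))) := by
          rw [hδ]
          apply Real.exp_le_exp.2
          nlinarith
        have h3 : δ / 2 ≤ (1 + (K ϱ t0).trace)⁻¹ := by
          have := key
          linarith
        have h4 : 1 + (K ϱ t0).trace ≤ (δ / 2)⁻¹ := by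
          rw [← inv_inv (1 + (K ϱ t0).trace)]
          exact inv_anti₀ (by positivity) h3
        rw [inv_div] at h4
        linarith [psd_norm_le_trace (hP t0 (left_mem_Icc.2 h0T))]
      · intro t ht
        have hPt := hP t (Ioo_subset_Icc_self ht)
        have hw1 := hw t (Ioo_subset_Icc_self ht)
        have hKw : ‖K ϱ t‖ ≤ 1 + (K ϱ t).trace := by linarith [psd_norm_le_trace hPt]
        obtain ⟨s11, s12, s13, s14, s22, s23, s24, s33, s44⟩ := hsym t
        obtain ⟨c11, c12, c13, c14, c21, c22, c23, c24, c31, c32, c41, c42⟩ :=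
          hC t ⟨by linarith [ht.1], ht.2.le⟩
        have f1 := F_norm hβ hPt s33 (hN33 t ht.2.le)
        have f2 := F_norm hβ hPt s44 (hN44 t ht.2.le)
        generalize 1 + (K ϱ t).trace = w at *
        have u1 := quad_bound hC0 hw1 c23 c13 c32 c31 f1 hKw
        have u2 := quad_bound hC0 hw1 c24 c14 c42 c41 f2 hKw
        rw [← hD1] at u1 u2
        have u3 := norm_mul_le_of hKw c21
        have u4 := norm_mul_le_of c12 hKw
        have u5 := norm_mul_le_of (norm_mul_le_of hKw c22) hKw
        have hsqle : ϱ ^ 2 ≤ |ϱ| := by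
          rw [← sq_abs]
          nlinarith [abs_nonneg ϱ]
        have v5 : ‖ϱ • (K ϱ t * H22 t * K ϱ t)‖ ≤ |ϱ| * (n * (n * w * C) * w) := by
          rw [norm_smul, Real.norm_eq_abs]
          gcongr
        have v1 : ∀ X : Matrix (Fin n) (Fin n) ℝ, ‖X‖ ≤ D1 * w ^ 2 →
            ‖(ϱ ^ 2) • X‖ ≤ |ϱ| * (D1 * w ^ 2) := by
          intro X hX
          rw [norm_smul, Real.norm_eq_abs, abs_of_nonneg (sq_nonneg ϱ)]
          gcongr
        have v11 := v1 _ u1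
        have v12 := v1 _ u2
        have hR : ‖Ric H11 H12 H13 H14 H21 H22 H23 H24 H31 H32 H33 H41 H42 H44 ϱ t (K ϱ t)‖ ≤
            n * w * C + n * C * w + C + |ϱ| * (n * (n * w * C) * w) + |ϱ| * (D1 * w ^ 2)
              + |ϱ| * (D1 * w ^ 2) := by
          unfold Ric
          refine (norm_add_le_of_le (norm_add_le_of_le (norm_add_le_of_le (norm_add_le_of_le
            (norm_add_le_of_le u3 u4) c11) v5) v11) v12)
        refine (trace_le_norm _).trans ((mul_le_mul_of_nonneg_left hR (by positivity)).trans ?_)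
        have g1 : C ≤ C * w := by nlinarith
        have hw0 : 0 ≤ w := by linarith
        have g2 : n * w * C + n * C * w + C + |ϱ| * (n * (n * w * C) * w) + |ϱ| * (D1 * w ^ 2)
              + |ϱ| * (D1 * w ^ 2) ≤
            (2 * (n * C) + C + n * (n * C) + 2 * D1) * w +
              |ϱ| * (2 * (n * C) + C + n * (n * C) + 2 * D1) * w ^ 2 := by
          have t1 : 0 ≤ (n * (n * C) + 2 * D1) * w := by positivity
          have t2 : 0 ≤ |ϱ| * (2 * (n * C) + C) * w ^ 2 := by positivity
          linarith
        refine (mul_le_mul_of_nonneg_left g2 (by positivity)).trans (le_of_eq ?_)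
        rw [hD]; ring
    by_contra hge
    push Not at hge
    have hbot : ⊥ < tb ϱ := (EReal.bot_lt_coe x).trans_le hge
    have hcoe : ((tb ϱ).toReal : EReal) = tb ϱ :=
      EReal.coe_toReal ((htbT ϱ).trans (EReal.coe_lt_top T)).ne hbot.ne'
    have hbl := hblow ϱ hbot
    generalize (tb ϱ).toReal = s at *
    have hsT : s < T := by
      have := htbT ϱ
      rw [← hcoe] at this
      exact_mod_cast this
    have hxs : x ≤ s := by
      rw [← hcoe] at hge
      exact_mod_cast hge
    have e1 := hbl.eventually_gt_atTop (2 / δ)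
    have e2 : ∀ᶠ t in nhdsWithin s (Ioi s), t ∈ Ioo s T := Ioo_mem_nhdsGT hsT
    obtain ⟨t, h1, h2⟩ := (e1.and e2).exists
    have := bound t (by linarith [h2.1]) h2.2.le (by rw [← hcoe]; exact_mod_cast h2.1)
    linarith
end
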